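/- Let f ∈ C¹([1,T]) attain its minimum over [1,T] at a point t₀ ∈ (1,T]. Then for any 0 < α < 1, the Hadamard-type fractional derivative satisfies D_*^α f(t₀) ≤ (log t₀)^{-α}/Γ(1-α) · (f(t₀) - f(1)) ≤ 0. -/

import Mathlib

open Real MeasureTheory Set

/-- Caputo–Hadamard fractional derivative of order `α` with base point `1`. -/
noncomputable def caputoHadamard (α : ℝ) (f : ℝ → ℝ) (t : ℝ) : ℝ :=
  (1 / Real.Gamma (1 - α)) * ∫ s in (1:ℝ)..t, (Real.log (t / s)) ^ (-α) * deriv f s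

theorem caputoHadamard_extremum_min
    (T : ℝ) (hT : 1 < T) (f : ℝ → ℝ)
    (hf : ContDiffOn ℝ 1 f (Set.Icc 1 T))
    (t₀ : ℝ) (ht₀ : t₀ ∈ Set.Ioc (1:ℝ) T)
    (hmin : ∀ t ∈ Set.Icc (1:ℝ) T, f t₀ ≤ f t)
    (α : ℝ) (hα0 : 0 < α) (hα1 : α < 1) :
    caputoHadamard α f t₀ ≤ (Real.log t₀) ^ (-α) / Real.Gamma (1 - α) * (f t₀ - f 1) ∧
      (Real.log t₀) ^ (-α) / Real.Gamma (1 - α) * (f t₀ - f 1) ≤ 0 := by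
  obtain ⟨h1, h2⟩ := ht₀
  have hG : 0 < Real.Gamma (1 - α) := Real.Gamma_pos_of_pos (by linarith)
  have hl : 0 < Real.log t₀ := Real.log_pos h1
  have ht0 : 0 < t₀ := by linarith
  have hsub : Set.Icc 1 t₀ ⊆ Set.Icc 1 T := Set.Icc_subset_Icc_right h2
  refine ⟨?_, mul_nonpos_of_nonneg_of_nonpos (by positivity)
    (by linarith [hmin 1 ⟨le_refl _, hT.le⟩])⟩
  have hdc : ContinuousOn (derivWithin f (Set.Icc 1 T)) (Set.Icc 1 T) :=
    hf.continuousOn_derivWithin (uniqueDiffOn_Icc hT) le_rfl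
  have hdf : DifferentiableOn ℝ f (Set.Icc 1 T) := hf.differentiableOn one_ne_zero
  obtain ⟨C, hC⟩ := isCompact_Icc.exists_bound_of_continuousOn hdc
  have hC0 : 0 ≤ C := (norm_nonneg _).trans (hC 1 ⟨le_refl _, hT.le⟩)
  have hder : ∀ s ∈ Set.Ioo 1 t₀, HasDerivAt f (deriv f s) s := fun s hs =>
    ((hdf s (hsub ⟨hs.1.le, hs.2.le⟩)).differentiableAt
      (Icc_mem_nhds hs.1 (hs.2.trans_le h2))).hasDerivAt
  have hbd : ∀ s ∈ Set.Ioo 1 t₀, ‖deriv f s‖ ≤ C := fun s hs => by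
    rw [← derivWithin_of_mem_nhds (Icc_mem_nhds hs.1 (hs.2.trans_le h2))]
    exact hC s (hsub ⟨hs.1.le, hs.2.le⟩)
  have hlip : ∀ s ∈ Set.Icc 1 t₀, f s - f t₀ ≤ C * (t₀ - s) := fun s hs => by
    have := (convex_Icc (1:ℝ) T).norm_image_sub_le_of_norm_derivWithin_le hdf hC
      (hsub ⟨h1.le, le_refl t₀⟩) (hsub hs)
    rw [Real.norm_eq_abs, Real.norm_eq_abs, abs_sub_comm s, abs_of_nonneg (sub_nonneg.2 hs.2)] at this
    exact (le_abs_self _).trans this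
  have hlog : ∀ s ∈ Set.Ico 1 t₀, (t₀ - s) / t₀ ≤ Real.log (t₀ / s) := fun s hs => by
    have hs0 : 0 < s := by linarith [hs.1]
    have := Real.one_sub_inv_le_log_of_pos (div_pos ht0 hs0)
    rwa [inv_div, one_sub_div ht0.ne'] at this
  have hpos : ∀ s ∈ Set.Ico 1 t₀, 0 < (t₀ - s) / t₀ := fun s hs =>
    div_pos (sub_pos.2 hs.2) ht0
  have hk : ∀ s ∈ Set.Ico 1 t₀, Real.log (t₀ / s) ^ (-α) ≤ ((t₀ - s) / t₀) ^ (-α) := fun s hs =>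
    Real.rpow_le_rpow_of_nonpos (hpos s hs) (hlog s hs) (by linarith)
  have hint : IntegrableOn (fun s => Real.log (t₀ / s) ^ (-α) * deriv f s) (Set.Icc 1 t₀) := by
    rw [integrableOn_Icc_iff_integrableOn_Ioo]
    have hI : IntegrableOn (fun s => (t₀ - s) ^ (-α) / t₀ ^ (-α) * C) (Set.Ioo 1 t₀) := by
      have := (intervalIntegral.intervalIntegrable_rpow' (a := t₀ - 1) (b := 0) (r := -α)
        (by linarith)).comp_sub_left t₀
      simp only [sub_sub_cancel, sub_zero] at this
      rw [intervalIntegrable_iff_integrableOn_Ioo_of_le h1.le] at this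
      exact (this.div_const _).mul_const _
    refine Integrable.mono' hI ?_ ?_
    · refine Measurable.aestronglyMeasurable ?_
      exact ((Real.measurable_log.comp (measurable_const.div measurable_id)).pow_const _).mul
        (measurable_deriv f)
    · filter_upwards [ae_restrict_mem measurableSet_Ioo] with s hs
      have hs' : s ∈ Set.Ico 1 t₀ := ⟨hs.1.le, hs.2⟩
      have hp := (hpos s hs').trans_le (hlog s hs')
      rw [norm_mul, Real.norm_of_nonneg (Real.rpow_nonneg hp.le _),
        ← Real.div_rpow (sub_nonneg.2 hs.2.le) ht0.le]
      exact mul_le_mul (hk s hs') (hbd s hs) (norm_nonneg _) (Real.rpow_nonneg (hpos s hs').le _)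
  have hFder : ∀ s ∈ Set.Ioo 1 t₀, HasDerivAt (fun s => Real.log (t₀ / s) ^ (-α) * (f s - f t₀))
      ((1 / s * α * Real.log (t₀ / s) ^ (-α - 1)) * (f s - f t₀)
        + Real.log (t₀ / s) ^ (-α) * deriv f s) s := fun s hs => by
    have hs' : s ∈ Set.Ico 1 t₀ := ⟨hs.1.le, hs.2⟩
    have hs0 : 0 < s := by linarith [hs.1]
    have hp := (hpos s hs').trans_le (hlog s hs')
    have d1 : HasDerivAt (fun s => t₀ / s) (-t₀ / s ^ 2) s := by
      have := (hasDerivAt_inv hs0.ne').const_mul t₀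
      simp only [div_eq_mul_inv]
      exact this.congr_deriv (by ring)
    have d2 := (d1.log (div_pos ht0 hs0).ne').rpow_const (p := -α) (Or.inl hp.ne')
    have d3 := d2.mul ((hder s hs).sub_const (f t₀))
    refine d3.congr_deriv ?_
    congr 2
    field_simp
  have hFc : ContinuousOn (fun s => Real.log (t₀ / s) ^ (-α) * (f s - f t₀)) (Set.Icc 1 t₀) := by
    intro s hs
    rcases hs.2.lt_or_eq with hlt | rfl
    · have hs' : s ∈ Set.Ico 1 t₀ := ⟨hs.1, hlt⟩
      have hs0 : 0 < s := by linarith [hs.1]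
      have hp := (hpos s hs').trans_le (hlog s hs')
      refine ContinuousWithinAt.mul ?_
        (((hdf.continuousOn.mono hsub) s hs).sub continuousWithinAt_const)
      refine ContinuousAt.continuousWithinAt ?_
      exact ((continuousAt_const.div continuousAt_id hs0.ne').log
        (div_pos ht0 hs0).ne').rpow_const (Or.inl hp.ne')
    · have hlim : Filter.Tendsto (fun r => C * s * ((s - r) / s) ^ (1 - α))
          (nhdsWithin s (Set.Icc 1 s)) (nhds 0) := by
        have : Continuous (fun r => C * s * ((s - r) / s) ^ (1 - α)) :=
          continuous_const.mul (((continuous_const.sub continuous_id).div_const s).rpow_const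
            (fun _ => Or.inr (by linarith)))
        have h := this.continuousWithinAt (s := Set.Icc 1 s) (x := s)
        simpa [ContinuousWithinAt, Real.zero_rpow (by linarith : (1 - α) ≠ 0)] using h
      simp only [ContinuousWithinAt, sub_self, mul_zero]
      refine squeeze_zero' ?_ ?_ hlim
      · filter_upwards [self_mem_nhdsWithin] with r hr
        have hr0 : 0 < r := by linarith [hr.1]
        exact mul_nonneg (Real.rpow_nonneg (Real.log_nonneg ((one_le_div hr0).2 hr.2)) _)
          (sub_nonneg.2 (hmin r (hsub hr)))
      · filter_upwards [self_mem_nhdsWithin] with r hr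
        rcases hr.2.lt_or_eq with hlt | rfl
        · have hr' : r ∈ Set.Ico 1 s := ⟨hr.1, hlt⟩
          have := mul_le_mul (hk r hr') (hlip r hr) (sub_nonneg.2 (hmin r (hsub hr)))
            (Real.rpow_nonneg (hpos r hr').le _)
          refine this.trans_eq ?_
          rw [sub_eq_add_neg 1 α, Real.rpow_add (hpos r hr'), Real.rpow_one]
          field_simp
        · simp [Real.zero_rpow (by linarith : (1 - α) ≠ 0)]
  have key := intervalIntegral.integral_le_sub_of_hasDeriv_right_of_le h1.le hFc
    (fun s hs => (hFder s hs).hasDerivWithinAt) hint (fun s hs => by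
      have hs' : s ∈ Set.Ico 1 t₀ := ⟨hs.1.le, hs.2⟩
      have hs0 : 0 < s := by linarith [hs.1]
      have hp := (hpos s hs').trans_le (hlog s hs')
      have hg := sub_nonneg.2 (hmin s (hsub ⟨hs.1.le, hs.2.le⟩))
      have : 0 ≤ (1 / s * α * Real.log (t₀ / s) ^ (-α - 1)) * (f s - f t₀) := by positivity
      linarith)
  simp only [sub_self, mul_zero, div_one, zero_sub] at key
  unfold caputoHadamard
  calc _ ≤ 1 / Real.Gamma (1 - α) * -(Real.log t₀ ^ (-α) * (f 1 - f t₀)) :=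
        mul_le_mul_of_nonneg_left key (by positivity)
    _ = _ := by ring
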